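/- Let d ≥ 1 be an integer. Let S be a type, let r : S → S → Prop be a relation, and let P : S → ℝ^{d+1} be a function such that P(x) = P(y) whenever r x y. Let B̄ denote the closed unit ball of ℝ^{d+1} and D̄ the closed unit ball of ℝ^d. Suppose G : ℝ^{d+1} → S and H : ℝ^d → S are maps such that: (i) P ∘ G is continuous on B̄ and injective on B̄; (ii) P ∘ H is continuous on D̄ and injective on D̄; (iii) for every b ∈ B̄ there exists a ∈ D̄ such that r (H a) (G b). Then this leads to a contradiction (such data cannot exist). -/

import Mathlib

open Set Metric MeasureTheory
open scoped NNReal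

theorem IsPreconnected.inter_frontier_nonempty_of_isClosed {X : Type*} [TopologicalSpace X]
    {t s : Set X} (ht : IsPreconnected t) (hs : IsClosed s) (h : (t ∩ s).Nonempty)
    (h' : (t ∩ sᶜ).Nonempty) : (t ∩ frontier s).Nonempty := by
  by_contra hempty
  have hsub (z) (hz : z ∈ t) (hzs : z ∈ s) : z ∈ interior s := by
    by_contra hzi
    exact hempty ⟨z, hz, hs.frontier_eq ▸ ⟨hzs, hzi⟩⟩
  obtain ⟨z, -, hzi, hzc⟩ := ht (interior s) sᶜ isOpen_interior hs.isOpen_compl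
    (fun z hz ↦ (em (z ∈ s)).imp (hsub z hz) id) (h.imp fun z hz ↦ ⟨hz.1, hsub z hz.1 hz.2⟩) h'
  exact hzc (interior_subset hzi)

theorem LipschitzOnWith.lipschitzWith_indicator {E F : Type*} [NormedAddCommGroup E]
    [NormedSpace ℝ E] [NormedAddCommGroup F] {K : ℝ≥0} {g : E → F} {s : Set E}
    (hg : LipschitzOnWith K g s) (hs : IsClosed s) (h0 : ∀ x ∈ frontier s, g x = 0) :
    LipschitzWith K (s.indicator g) := by
  have key : ∀ x ∈ s, ∀ y ∉ s, dist (g x) 0 ≤ K * dist x y := by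
    intro x hx y hy
    obtain ⟨z, hz, hzs⟩ : (segment ℝ x y ∩ frontier s).Nonempty :=
      (convex_segment x y).isPreconnected.inter_frontier_nonempty_of_isClosed hs
        ⟨x, left_mem_segment ℝ x y, hx⟩ ⟨y, right_mem_segment ℝ x y, hy⟩
    rw [← h0 z hzs]
    refine (hg.dist_le_mul x hx z (hs.frontier_subset hzs)).trans ?_
    gcongr
    have := dist_add_dist_of_mem_segment hz
    linarith [dist_nonneg (x := z) (y := y)]
  refine LipschitzWith.of_dist_le_mul fun x y ↦ ?_
  by_cases hx : x ∈ s <;> by_cases hy : y ∈ s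
  · simpa [hx, hy] using hg.dist_le_mul x hx y hy
  · simpa [hx, hy] using key x hx y hy
  · simpa [hx, hy, dist_comm] using key y hy x hx
  · simp only [hx, hy, not_false_eq_true, indicator_of_notMem, dist_self]
    positivity

/-- A small Lipschitz perturbation of the identity that fixes the frontier of a closed set `s` and
maps `s` to itself is a bijection of `s`. -/
theorem bijOn_add_smul_of_lipschitzOnWith {E : Type*} [NormedAddCommGroup E]
    [NormedSpace ℝ E] [CompleteSpace E] {K : ℝ≥0} {g : E → E} {s : Set E}
    (hg : LipschitzOnWith K g s) (hs : IsClosed s) (h0 : ∀ x ∈ frontier s, g x = 0)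
    {t : ℝ} (ht : 0 ≤ t) (htK : t * K < 1) (hmaps : MapsTo (fun x ↦ x + t • g x) s s) :
    BijOn (fun x ↦ x + t • g x) s s := by
  lift t to ℝ≥0 using ht
  have hlip := hg.lipschitzWith_indicator hs h0
  have hcontr (y : E) : ContractingWith (t * K) fun x ↦ y - (t : ℝ) • s.indicator g x := by
    refine ⟨by exact_mod_cast htK, LipschitzWith.of_dist_le_mul fun a b ↦ ?_⟩
    rw [dist_sub_left, dist_smul₀]
    simpa [mul_assoc] using mul_le_mul_of_nonneg_left (hlip.dist_le_mul a b) t.2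
  refine ⟨hmaps, fun x hx y hy hxy ↦ ?_, fun y hy ↦ ?_⟩
  · simp only at hxy
    refine (hcontr (x + (t : ℝ) • g x)).fixedPoint_unique' ?_ ?_
    · simp [Function.IsFixedPt, hx]
    · simp [Function.IsFixedPt, hy, hxy]
  · have : Nonempty E := ⟨y⟩
    obtain ⟨x, hx⟩ : ∃ x, y - (t : ℝ) • s.indicator g x = x :=
      ⟨_, (hcontr y).fixedPoint_isFixedPt⟩
    have hxs : x ∈ s := by
      by_contra h
      simp only [h, not_false_eq_true, indicator_of_notMem, smul_zero, sub_zero] at hx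
      exact h (hx ▸ hy)
    refine ⟨x, hxs, ?_⟩
    rw [indicator_of_mem hxs] at hx
    exact (sub_eq_iff_eq_add.1 hx).symm

/-- Lagrange interpolation of the polynomial `t ↦ det (1 + t • A)` at nodes in `(0, τ)`. -/
theorem exists_finset_det_one_add_eq_sum {E : Type*} [NormedAddCommGroup E]
    [NormedSpace ℝ E] [FiniteDimensional ℝ E] {τ : ℝ} (hτ : 0 < τ) :
    ∃ (s : Finset ℝ) (w : ℝ → ℝ), (∀ t ∈ s, t ∈ Ioo 0 τ) ∧ ∑ t ∈ s, w t = 1 ∧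
      ∀ A : E →L[ℝ] E, (1 + A).det = ∑ t ∈ s, w t * (1 + t • A).det := by
  classical
  let b := Module.finBasis ℝ E
  obtain ⟨s, hs, hcard⟩ := (Ioo_infinite hτ).exists_subset_card_eq (Module.finrank ℝ E + 1)
  have hne : s.Nonempty := Finset.card_pos.1 (by omega)
  have hinj : InjOn (id : ℝ → ℝ) s := injOn_id _
  refine ⟨s, fun t ↦ (Lagrange.basis s id t).eval 1, fun t ht ↦ hs ht, ?_, fun A ↦ ?_⟩
  · rw [← Polynomial.eval_finsetSum, Lagrange.sum_basis hinj hne, Polynomial.eval_one]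
  · let M := LinearMap.toMatrix b b (A : E →ₗ[ℝ] E)
    let p : Polynomial ℝ := ((Polynomial.X : Polynomial ℝ) • M.map Polynomial.C +
      (1 : Matrix _ _ ℝ).map Polynomial.C).det
    have hp (t : ℝ) : p.eval t = (1 + t • A).det := by
      rw [ContinuousLinearMap.det, ← LinearMap.det_toMatrix b, ← Polynomial.coe_evalRingHom,
        RingHom.map_det]
      congr 1
      ext i j
      simp [M, LinearMap.toMatrix_one, Matrix.one_apply, mul_comm t, apply_ite (Polynomial.eval t)]
      ring
    have hdeg : p.degree < s.card := by
      refine Polynomial.degree_le_natDegree.trans_lt ?_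
      have := Polynomial.natDegree_det_X_add_C_le M 1
      rw [Fintype.card_fin, ← Nat.lt_succ_iff, Nat.succ_eq_add_one, ← hcard] at this
      exact_mod_cast this
    have h := congrArg (Polynomial.eval 1) (Lagrange.eq_interpolate hinj hdeg)
    simpa [Lagrange.interpolate_apply, Polynomial.eval_finsetSum, hp, mul_comm] using h

theorem setIntegral_det_one_add_smul_fderiv {E : Type*} [NormedAddCommGroup E]
    [NormedSpace ℝ E] [FiniteDimensional ℝ E] [MeasurableSpace E] [BorelSpace E]
    (μ : Measure E) [μ.IsAddHaarMeasure] {g : E → E} {s : Set E} (hs : MeasurableSet s)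
    (hg : Differentiable ℝ g) {t : ℝ} (hbij : BijOn (fun x ↦ x + t • g x) s s)
    (hdet : ∀ x ∈ s, 0 < (1 + t • fderiv ℝ g x).det) :
    ∫ x in s, (1 + t • fderiv ℝ g x).det ∂μ = μ.real s := by
  have h := integral_image_eq_integral_abs_det_fderiv_smul μ hs
    (f := fun x ↦ x + t • g x) (f' := fun x ↦ 1 + t • fderiv ℝ g x)
    (fun x _ ↦ ((hasFDerivAt_id x).add ((hg x).hasFDerivAt.const_smul t)).hasFDerivWithinAt)
    hbij.injOn (fun _ ↦ (1 : ℝ))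
  rw [hbij.image_eq] at h
  simp only [integral_const, smul_eq_mul, mul_one, measureReal_restrict_apply_univ] at h
  rw [h]
  exact setIntegral_congr_fun hs fun x hx ↦ (abs_of_pos (hdet x hx)).symm

theorem det_fderiv_eq_zero_of_norm_eq_one {E : Type*} [NormedAddCommGroup E]
    [InnerProductSpace ℝ E] [FiniteDimensional ℝ E] {f : E → E} (hf : Differentiable ℝ f)
    (hnorm : ∀ x, ‖f x‖ = 1) (x : E) : (fderiv ℝ f x).det = 0 := by
  by_contra hdet
  have hsurj : Function.Surjective (fderiv ℝ f x) :=
    ((LinearMap.isUnit_iff_isUnit_det _).2 (isUnit_iff_ne_zero.2 hdet) |>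
      (Module.End.isUnit_iff _).1).2
  obtain ⟨v, hv⟩ := hsurj (f x)
  have hconst : (fun y ↦ inner ℝ (f y) (f y)) = fun _ ↦ (1 : ℝ) := by
    ext y
    simp [hnorm]
  have h := fderiv_inner_apply ℝ (hf x) (hf x) v
  rw [hconst, hv] at h
  norm_num [hnorm] at h

/-- There is no `C¹` retraction onto the unit sphere. Rogers' volume argument: with `g = f - id`,
the map `x ↦ x + t • g x` permutes the unit ball for small `t > 0`, so `∫ det (1 + t • Dg)`, which
is polynomial in `t`, is the volume of the ball for all `t`, while at `t = 1` it vanishes. -/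
theorem not_exists_contDiff_retraction_sphere {E : Type*} [NormedAddCommGroup E]
    [InnerProductSpace ℝ E] [FiniteDimensional ℝ E] {f : E → E} (hf : ContDiff ℝ 1 f)
    (hnorm : ∀ x, ‖f x‖ = 1) (hid : ∀ x, ‖x‖ = 1 → f x = x) : False := by
  borelize E
  let μ : Measure E := volume
  let B : Set E := closedBall 0 1
  have hB : IsCompact B := isCompact_closedBall 0 1
  let g : E → E := fun x ↦ f x - x
  have hg : ContDiff ℝ 1 g := hf.sub contDiff_id
  have hgd : Differentiable ℝ g := hg.differentiable one_ne_zero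
  have hg' : Continuous (fderiv ℝ g) := hg.continuous_fderiv one_ne_zero
  obtain ⟨C, hC⟩ := hB.exists_bound_of_continuousOn hg'.continuousOn
  let K : ℝ≥0 := C.toNNReal
  have hK (x) (hx : x ∈ B) : ‖fderiv ℝ g x‖ ≤ K := (hC x hx).trans (Real.le_coe_toNNReal C)
  have hlip : LipschitzOnWith K g B :=
    (convex_closedBall 0 1).lipschitzOnWith_of_nnnorm_fderiv_le (fun x _ ↦ hgd x) hK
  have h0 : ∀ x ∈ frontier B, g x = 0 := fun x hx ↦ by
    have := frontier_closedBall_subset_sphere hx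
    simp [g, hid x (by simpa using this)]
  obtain ⟨δ, hδ, hdet⟩ : ∃ δ > 0, ∀ T : E →L[ℝ] E, dist T 1 < δ → 0 < T.det := by
    have : ∀ᶠ T in nhds (1 : E →L[ℝ] E), 0 < T.det :=
      ContinuousLinearMap.continuous_det.continuousAt.eventually_const_lt
        (by simp [ContinuousLinearMap.det])
    exact Metric.eventually_nhds_iff.1 this
  let τ : ℝ := min δ 1 / (K + 1)
  have hτ : 0 < τ := by positivity
  have hτK : τ * (K + 1) = min δ 1 := div_mul_cancel₀ _ (by positivity)
  obtain ⟨s, w, hs, hw, hsum⟩ := exists_finset_det_one_add_eq_sum (E := E) hτ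
  have hvol (t) (ht : t ∈ s) : ∫ x in B, (1 + t • fderiv ℝ g x).det ∂μ = μ.real B := by
    obtain ⟨ht0, htτ⟩ := hs t ht
    have htK : t * K < min δ 1 := by
      rw [← hτK]
      nlinarith [K.2]
    have ht1 : t ≤ 1 := htτ.le.trans <|
      (div_le_self (by positivity) (by simp)).trans (min_le_right _ _)
    refine setIntegral_det_one_add_smul_fderiv μ hB.measurableSet hgd
      (bijOn_add_smul_of_lipschitzOnWith hlip hB.isClosed h0 ht0.le
        (htK.trans_le (min_le_right _ _)) fun x hx ↦ ?_) fun x hx ↦ hdet _ ?_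
    · have : x + t • g x = (1 - t) • x + t • f x := by simp only [g]; module
      simp only [this]
      exact convex_closedBall 0 1 hx (by simp [hnorm]) (by linarith) ht0.le (by ring)
    · rw [dist_eq_norm, add_sub_cancel_left, norm_smul, Real.norm_of_nonneg ht0.le]
      exact (mul_le_mul_of_nonneg_left (hK x hx) ht0.le).trans_lt
        (htK.trans_le (min_le_left _ _))
  have hzero (x : E) : (1 + fderiv ℝ g x).det = 0 := by
    have : fderiv ℝ g x = fderiv ℝ f x - 1 :=
      ((hf.differentiable one_ne_zero x).hasFDerivAt.sub (hasFDerivAt_id x)).fderiv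
    rw [this, add_sub_cancel]
    exact det_fderiv_eq_zero_of_norm_eq_one (hf.differentiable one_ne_zero) hnorm x
  have hint (t : ℝ) : IntegrableOn (fun x ↦ w t * (1 + t • fderiv ℝ g x).det) B μ :=
    ((ContinuousLinearMap.continuous_det.comp
      (continuous_const.add (hg'.const_smul t))).const_mul (w t)).continuousOn
        |>.integrableOn_compact hB
  have htotal : ∫ x in B, (1 + fderiv ℝ g x).det ∂μ = μ.real B := by
    rw [integral_congr_ae (.of_forall fun x ↦ hsum (fderiv ℝ g x)),
      integral_finsetSum _ fun t _ ↦ hint t]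
    simp_rw [integral_const_mul]
    rw [Finset.sum_congr rfl fun t ht ↦ by rw [hvol t ht], ← Finset.sum_mul, hw, one_mul]
  have hpos : 0 < μ.real B :=
    ENNReal.toReal_pos (measure_closedBall_pos μ 0 one_pos).ne' hB.measure_lt_top.ne
  simp only [hzero, integral_zero] at htotal
  exact hpos.ne htotal

/-- A `C¹` map close to the identity on the unit ball has a zero there. -/
theorem exists_eq_zero_of_norm_sub_le_half {E : Type*} [NormedAddCommGroup E]
    [InnerProductSpace ℝ E] [FiniteDimensional ℝ E] {F : E → E} (hF : ContDiff ℝ 1 F)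
    (hle : ∀ x, ‖x‖ ≤ 1 → ‖F x - x‖ ≤ 1 / 2) : ∃ x, ‖x‖ ≤ 1 ∧ F x = 0 := by
  by_contra! hne
  let χ : ContDiffBump (0 : E) := ⟨3 / 4, 1, by norm_num, by norm_num⟩
  let Φ : E → E := fun x ↦ x + χ x • (F x - x)
  have hΦ : ContDiff ℝ 1 Φ := contDiff_id.add (χ.contDiff.smul (hF.sub contDiff_id))
  have hout (x) (hx : 1 ≤ ‖x‖) : Φ x = x := by
    simp [Φ, χ.zero_of_le_dist (x := x) (by simpa [χ] using hx)]
  have hΦ0 (x) : Φ x ≠ 0 := by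
    intro h
    rcases le_or_gt ‖x‖ (3 / 4) with hx | hx
    · refine hne x (by linarith) ?_
      simpa [Φ, χ.one_of_mem_closedBall (x := x) (by simpa [χ] using hx)] using h
    rcases le_or_gt 1 ‖x‖ with hx1 | hx1
    · rw [hout x hx1] at h
      norm_num [h] at hx1
    · have h1 : ‖χ x • (F x - x)‖ ≤ 1 / 2 := by
        rw [norm_smul, Real.norm_of_nonneg χ.nonneg]
        nlinarith [χ.le_one (x := x), χ.nonneg (x := x), hle x hx1.le, norm_nonneg (F x - x)]
      have h2 : ‖x‖ = ‖χ x • (F x - x)‖ := by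
        simpa using congrArg norm (eq_neg_of_add_eq_zero_left h)
      linarith
  refine not_exists_contDiff_retraction_sphere (f := fun x ↦ ‖Φ x‖⁻¹ • Φ x)
    (((hΦ.norm ℝ hΦ0).inv fun x ↦ norm_ne_zero_iff.2 (hΦ0 x)).smul hΦ) (fun x ↦ ?_) fun x hx ↦ ?_
  · exact norm_smul_inv_norm (𝕜 := ℝ) (hΦ0 x)
  · simp [hout x hx.ge, hx]

/-- There is no continuous injection of the closed unit ball into a space of lower dimension. -/
theorem not_injective_of_continuous_closedBall_of_finrank_lt {E E' : Type*} [NormedAddCommGroup E]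
    [InnerProductSpace ℝ E] [FiniteDimensional ℝ E] [NormedAddCommGroup E']
    [NormedSpace ℝ E'] [FiniteDimensional ℝ E']
    (hlt : Module.finrank ℝ E' < Module.finrank ℝ E) {f : closedBall (0 : E) 1 → E'}
    (hf : Continuous f) : ¬ Function.Injective f := by
  intro hinj
  have : CompactSpace (closedBall (0 : E) 1) :=
    isCompact_iff_compactSpace.1 (isCompact_closedBall 0 1)
  obtain ⟨g, hg⟩ := ContinuousMap.exists_extension (hf.isClosedEmbedding hinj)
    (⟨Subtype.val, continuous_subtype_val⟩ : C(closedBall (0 : E) 1, E))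
  obtain ⟨f', hf'⟩ := ContinuousMap.exists_extension
    (isClosed_closedBall (x := (0 : E)) (ε := 1)).isClosedEmbedding_subtypeVal
    (⟨f, hf⟩ : C(closedBall (0 : E) 1, E'))
  have hgf (x : E) (hx : ‖x‖ ≤ 1) : g (f' x) = x := by
    have hx' : x ∈ closedBall (0 : E) 1 := by simpa using hx
    have h1 : f' x = f ⟨x, hx'⟩ := DFunLike.congr_fun hf' ⟨x, hx'⟩
    rw [h1]
    exact DFunLike.congr_fun hg ⟨x, hx'⟩
  obtain ⟨h, hh, hhg, -⟩ := g.continuous.exists_contDiff_approx 1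
    (continuous_const (y := (1 / 8 : ℝ))) fun _ ↦ by norm_num
  obtain ⟨c, hc, hch⟩ := (hh.dense_compl_range_of_finrank_lt_finrank hlt).exists_dist_lt 0
    (show (0 : ℝ) < 1 / 8 by norm_num)
  have hne (x : E) : h (f' x) - c ≠ 0 := fun h0 ↦ hc ⟨f' x, sub_eq_zero.1 h0⟩
  have hcont : Continuous fun x ↦ h (f' x) - c := by
    have := hh.continuous
    fun_prop
  obtain ⟨F, hF, hFh, -⟩ := hcont.exists_contDiff_approx 1
    (ε := fun x ↦ min (1 / 4) ‖h (f' x) - c‖) (continuous_const.min hcont.norm)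
    fun x ↦ lt_min (by norm_num) (norm_pos_iff.2 (hne x))
  obtain ⟨x, -, hx⟩ := exists_eq_zero_of_norm_sub_le_half hF fun x hx ↦ by
    have h1 := (hFh x).trans_le (min_le_left _ _)
    have h2 := hhg (f' x)
    rw [hgf x hx, dist_eq_norm] at h2
    rw [dist_eq_norm] at h1
    rw [dist_zero_left] at hch
    calc ‖F x - x‖ = ‖(F x - (h (f' x) - c)) + (h (f' x) - x) - c‖ := by congr 1; abel
      _ ≤ ‖F x - (h (f' x) - c)‖ + ‖h (f' x) - x‖ + ‖c‖ :=
        (norm_sub_le _ _).trans (by gcongr; exact norm_add_le _ _)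
      _ ≤ 1 / 2 := by linarith
  have h3 := (hFh x).trans_le (min_le_right _ _)
  rw [hx, dist_zero_left] at h3
  exact h3.false

/-- abstract Theorem A.3: let `r` be a relation on `S` and
`P : S → ℝ^{d+1}` constant on `r`-related pairs. If `P ∘ G` is continuous and injective on
the closed unit ball `B̄` of `ℝ^{d+1}`, `P ∘ H` is continuous and injective on the closed
unit ball `D̄` of `ℝ^d`, and every `G b` with `b ∈ B̄` is `r`-related to some `H a` with
`a ∈ D̄`, then we get a contradiction. -/
theorem no_full_family_of_tangency_family
    (d : ℕ) (hd : 1 ≤ d) (S : Type*) (r : S → S → Prop)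
    (P : S → EuclideanSpace ℝ (Fin (d + 1)))
    (hP : ∀ x y : S, r x y → P x = P y)
    (G : EuclideanSpace ℝ (Fin (d + 1)) → S)
    (H : EuclideanSpace ℝ (Fin d) → S)
    (hG1 : ContinuousOn (P ∘ G) (Metric.closedBall 0 1))
    (hG2 : Set.InjOn (P ∘ G) (Metric.closedBall 0 1))
    (hH1 : ContinuousOn (P ∘ H) (Metric.closedBall 0 1))
    (hH2 : Set.InjOn (P ∘ H) (Metric.closedBall 0 1))
    (hfull : ∀ b ∈ Metric.closedBall (0 : EuclideanSpace ℝ (Fin (d + 1))) 1,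
      ∃ a ∈ Metric.closedBall (0 : EuclideanSpace ℝ (Fin d)) 1, r (H a) (G b)) :
    False := by
  have : CompactSpace (closedBall (0 : EuclideanSpace ℝ (Fin d)) 1) :=
    isCompact_iff_compactSpace.1 (isCompact_closedBall 0 1)
  have hemb := (continuousOn_iff_continuous_domRestrict.1 hH1).isClosedEmbedding hH2.injective
  choose a ha hra using hfull
  let φ (b : closedBall (0 : EuclideanSpace ℝ (Fin (d + 1))) 1) :
      closedBall (0 : EuclideanSpace ℝ (Fin d)) 1 := ⟨a b b.2, ha b b.2⟩
  have hφ : (closedBall 0 1).domRestrict (P ∘ H) ∘ φ = (closedBall 0 1).domRestrict (P ∘ G) :=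
    funext fun b ↦ hP _ _ (hra b b.2)
  have hφc : Continuous φ := by
    rw [hemb.isInducing.continuous_iff, hφ]
    exact continuousOn_iff_continuous_domRestrict.1 hG1
  have hφi : Function.Injective φ := by
    refine Function.Injective.of_comp (f := (closedBall 0 1).domRestrict (P ∘ H)) ?_
    rw [hφ]
    exact hG2.injective
  exact not_injective_of_continuous_closedBall_of_finrank_lt (by simp) (continuous_subtype_val.comp hφc)
    (Subtype.val_injective.comp hφi)
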